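/- arXiv:1409.2723 — 7 statements merged into one kernel-verified Lean document; each statement's English description precedes it below -/
import Mathlib

section
/- Let A ∈ ℝ^{n×n}, B ∈ ℝ^{n×m} satisfy Assumption 2 (the pair (A,B) is controllable and every eigenvalue of A has zero real part). Then for every γ > 0, the Lyapunov equation W(A + (γ/2)Iₙ)ᵀ + (A + (γ/2)Iₙ)W = BBᵀ has a unique solution W ∈ ℝ^{n×n}, and this unique solution is symmetric positive definite. -/
open Matrix MeasureTheory Filter Topology

/-- The pair `(A,B)` is controllable: the columns of `B, AB, …, A^{n-1}B` span `ℝ^n`. -/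
def Controllable {n m : ℕ} (A : Matrix (Fin n) (Fin n) ℝ) (B : Matrix (Fin n) (Fin m) ℝ) :
    Prop :=
  Submodule.span ℝ
    {v : Fin n → ℝ | ∃ (k : Fin n) (j : Fin m), v = (A ^ (k : ℕ)) *ᵥ (fun i => B i j)} = ⊤

theorem tendsto_pow_atTop_nhds_zero_of_forall_spectrum_norm_lt_one
    {E : Type*} [NormedRing E] [NormedAlgebra ℂ E] [CompleteSpace E] [Nontrivial E] (a : E)
    (ha : ∀ z ∈ spectrum ℂ a, ‖z‖ < 1) : Tendsto (fun k : ℕ => a ^ k) atTop (𝓝 0) := by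
  have hr : spectralRadius ℂ a < 1 := by
    simpa using spectrum.spectralRadius_lt_of_forall_lt a (r := 1) fun z hz => ha z hz
  obtain ⟨q, hq, hq1⟩ := ENNReal.lt_iff_exists_nnreal_btwn.1 hr
  have hq1 : q < 1 := by exact_mod_cast hq1
  refine squeeze_zero_norm' (a := fun k : ℕ => (q : ℝ) ^ k) ?_
    (tendsto_pow_atTop_nhds_zero_of_lt_one q.2 hq1)
  filter_upwards [(spectrum.pow_nnnorm_pow_one_div_tendsto_nhds_spectralRadius a).eventually_lt_const
    hq, eventually_gt_atTop 0] with k hk hk0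
  rw [one_div, ENNReal.rpow_inv_lt_iff (by exact_mod_cast hk0), ENNReal.rpow_natCast] at hk
  have hk : ‖a ^ k‖₊ < q ^ k := by exact_mod_cast hk
  exact_mod_cast hk.le

namespace Matrix

variable {ι κ : Type*} [Fintype ι] [DecidableEq ι] [Fintype κ]

open scoped Matrix.Norms.Operator in
/-- Powers of the Cayley transform `(1 + M)⁻¹ (1 - M)` tend to zero if the spectrum of `M` lies in
the open right half-plane. -/
theorem tendsto_pow_cayley {M T : Matrix ι ι ℂ} (hM : ∀ μ ∈ spectrum ℂ M, 0 < μ.re)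
    (hT : (1 + M) * T = 1 - M) : Tendsto (fun k : ℕ => T ^ k) atTop (𝓝 0) := by
  cases isEmpty_or_nonempty ι
  · simpa only [Subsingleton.elim _ (0 : Matrix ι ι ℂ)] using tendsto_const_nhds
  refine tendsto_pow_atTop_nhds_zero_of_forall_spectrum_norm_lt_one T fun z hz => ?_
  by_contra! hz1
  have hmul : (1 + M) * (algebraMap ℂ _ z - T) = (z - 1) • 1 + (z + 1) • M := by
    rw [mul_sub, hT, Algebra.algebraMap_eq_smul_one]
    simp only [mul_smul_comm, mul_one]
    module
  refine hz ?_
  suffices h : IsUnit ((z - 1) • (1 : Matrix ι ι ℂ) + (z + 1) • M) by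
    rw [← hmul, isUnit_iff_isUnit_det, det_mul] at h
    exact (isUnit_iff_isUnit_det _).2 (isUnit_of_mul_isUnit_right h)
  by_cases h1 : z + 1 = 0
  · rw [h1, zero_smul, add_zero, eq_neg_of_add_eq_zero_left h1]
    exact (isUnit_one (M := Matrix ι ι ℂ)).smul (Units.mk0 (-1 - 1 : ℂ) (by norm_num))
  · have hμ : ((1 - z) / (1 + z)).re ≤ 0 := by
      rw [Complex.div_re, ← add_div]
      refine div_nonpos_of_nonpos_of_nonneg ?_ (Complex.normSq_nonneg _)
      have : 1 ≤ Complex.normSq z := by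
        rw [Complex.normSq_eq_norm_sq]
        nlinarith
      rw [Complex.normSq_apply] at this
      simp
      nlinarith
    have hu : IsUnit (algebraMap ℂ (Matrix ι ι ℂ) ((1 - z) / (1 + z)) - M) := by
      by_contra h
      exact (hM _ h).not_ge hμ
    have h1' : 1 + z ≠ 0 := by rwa [add_comm]
    convert hu.smul (Units.mk0 (-(1 + z)) (neg_ne_zero.2 h1')) using 1
    rw [Units.smul_def, Units.val_mk0, smul_sub, Algebra.algebraMap_eq_smul_one, smul_smul,
      neg_mul, mul_div_cancel₀ _ h1']
    module

/-- A real matrix with spectrum in the open right half-plane has a Cayley transform whose powers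
tend to zero. -/
theorem exists_cayley {M : Matrix ι ι ℝ}
    (hM : ∀ μ ∈ spectrum ℂ (M.map Complex.ofReal), 0 < μ.re) :
    ∃ T : Matrix ι ι ℝ, IsUnit (1 + M) ∧ (1 + M) * T = 1 - M ∧
      Tendsto (fun k : ℕ => T ^ k) atTop (𝓝 0) := by
  have hadd : ((1 + M).map Complex.ofReal) = 1 + M.map Complex.ofReal := by
    ext i j
    by_cases h : i = j <;> simp [h]
  have hsub : ((1 - M).map Complex.ofReal) = 1 - M.map Complex.ofReal := by
    ext i j
    by_cases h : i = j <;> simp [h]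
  have hu : IsUnit (1 + M) := by
    have h : IsUnit (algebraMap ℂ (Matrix ι ι ℂ) (-1) - M.map Complex.ofReal) := by
      by_contra h
      exact absurd (hM _ h) (by norm_num)
    have h : IsUnit (1 + M.map Complex.ofReal) := by
      rw [← IsUnit.neg_iff]
      convert h using 1
      rw [map_neg, map_one, neg_add, sub_eq_add_neg]
    rw [← hadd, isUnit_iff_isUnit_det, isUnit_iff_ne_zero] at h
    rw [isUnit_iff_isUnit_det, isUnit_iff_ne_zero]
    intro h0
    refine h ?_
    have := Complex.ofRealHom.map_det (1 + M)
    rw [h0, map_zero] at this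
    exact this.symm
  have hT : (1 + M) * ((1 + M)⁻¹ * (1 - M)) = 1 - M := by
    rw [← mul_assoc, mul_nonsing_inv _ ((isUnit_iff_isUnit_det _).1 hu), one_mul]
  set T := (1 + M)⁻¹ * (1 - M)
  refine ⟨T, hu, hT, ?_⟩
  have hC : Tendsto (fun k : ℕ => T.map Complex.ofReal ^ k) atTop (𝓝 0) := by
    refine tendsto_pow_cayley hM ?_
    rw [← hadd, ← hsub, ← hT]
    exact (map_mul Complex.ofRealHom.mapMatrix _ _).symm
  have hre := ((continuous_id.matrix_map Complex.continuous_re).tendsto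
    (0 : Matrix ι ι ℂ)).comp hC
  convert hre using 1
  · ext k : 1
    have : T.map Complex.ofReal ^ k = (T ^ k).map Complex.ofReal :=
      (map_pow Complex.ofRealHom.mapMatrix T k).symm
    ext i j
    simp [this]
  · congr 1

/-- The Lyapunov operator `W ↦ W Mᵀ + M W`. -/
def lyapunov (M : Matrix ι ι ℝ) : Matrix ι ι ℝ →ₗ[ℝ] Matrix ι ι ℝ :=
  LinearMap.mulRight ℝ Mᵀ + LinearMap.mulLeft ℝ M

theorem lyapunov_apply (M W : Matrix ι ι ℝ) : lyapunov M W = W * Mᵀ + M * W := rfl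

/-- The Cayley transform turns a Lyapunov equation into a Stein equation. -/
theorem sub_cayley_conj {M T W : Matrix ι ι ℝ} (hu : IsUnit (1 + M))
    (hT : (1 + M) * T = 1 - M) :
    W - T * W * Tᵀ = (2 : ℝ) • ((1 + M)⁻¹ * (lyapunov M W) * ((1 + M)⁻¹)ᵀ) := by
  have hd := (isUnit_iff_isUnit_det _).1 hu
  have hT' : Tᵀ * (1 + M)ᵀ = (1 - M)ᵀ := by rw [← transpose_mul, hT]
  have key : (1 + M) * (W - T * W * Tᵀ) * (1 + M)ᵀ = (2 : ℝ) • lyapunov M W := by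
    calc (1 + M) * (W - T * W * Tᵀ) * (1 + M)ᵀ
        = (1 + M) * W * (1 + M)ᵀ - ((1 + M) * T) * W * (Tᵀ * (1 + M)ᵀ) := by noncomm_ring
      _ = (2 : ℝ) • lyapunov M W := by
        rw [hT, hT', lyapunov_apply, two_smul, transpose_add, transpose_sub, transpose_one]
        noncomm_ring
  have hd' : IsUnit (1 + M)ᵀ.det := by rwa [det_transpose]
  calc W - T * W * Tᵀ
      = ((1 + M)⁻¹ * (1 + M)) * (W - T * W * Tᵀ) * ((1 + M)ᵀ * ((1 + M)ᵀ)⁻¹) := by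
        rw [nonsing_inv_mul _ hd, mul_nonsing_inv _ hd', one_mul, mul_one]
    _ = (1 + M)⁻¹ * ((1 + M) * (W - T * W * Tᵀ) * (1 + M)ᵀ) * ((1 + M)ᵀ)⁻¹ := by
        simp only [mul_assoc]
    _ = _ := by rw [key, ← transpose_nonsing_inv, Matrix.mul_smul, Matrix.smul_mul]

theorem tendsto_pow_conj {T : Matrix ι ι ℝ} (hT : Tendsto (fun k : ℕ => T ^ k) atTop (𝓝 0))
    (W : Matrix ι ι ℝ) : Tendsto (fun k : ℕ => T ^ k * W * (T ^ k)ᵀ) atTop (𝓝 0) := by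
  have hc : Continuous fun X : Matrix ι ι ℝ => X * W * Xᵀ := by fun_prop
  simpa [Function.comp_def] using (hc.tendsto 0).comp hT

theorem lyapunov_injective {M : Matrix ι ι ℝ}
    (hM : ∀ μ ∈ spectrum ℂ (M.map Complex.ofReal), 0 < μ.re) :
    Function.Injective (lyapunov M) := by
  obtain ⟨T, hu, hT, hlim⟩ := exists_cayley hM
  rw [← LinearMap.ker_eq_bot, LinearMap.ker_eq_bot']
  intro W hW
  have hstep : T * W * Tᵀ = W := by
    have := sub_cayley_conj (W := W) hu hT
    rw [hW, mul_zero, zero_mul, smul_zero, sub_eq_zero] at this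
    exact this.symm
  have hpow : ∀ k : ℕ, T ^ k * W * (T ^ k)ᵀ = W := by
    intro k
    induction k with
    | zero => simp
    | succ k ih =>
      calc T ^ (k + 1) * W * (T ^ (k + 1))ᵀ = T ^ k * (T * W * Tᵀ) * (T ^ k)ᵀ := by
            rw [pow_succ, transpose_mul]
            simp only [mul_assoc]
        _ = W := by rw [hstep, ih]
  exact tendsto_nhds_unique (by simp only [hpow]; exact tendsto_const_nhds)
    (tendsto_pow_conj hlim W)

theorem posSemidef_of_lyapunov {M W : Matrix ι ι ℝ}
    (hM : ∀ μ ∈ spectrum ℂ (M.map Complex.ofReal), 0 < μ.re)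
    (hQ : (lyapunov M W).PosSemidef) : W.PosSemidef := by
  have hsymm : Wᵀ = W := by
    refine lyapunov_injective hM ?_
    have h : (lyapunov M W)ᵀ = lyapunov M W := by
      simpa [IsHermitian, conjTranspose_eq_transpose_of_trivial] using hQ.isHermitian
    rw [← h, lyapunov_apply, lyapunov_apply, transpose_add, transpose_mul, transpose_mul,
      transpose_transpose, add_comm]
  obtain ⟨T, hu, hT, hlim⟩ := exists_cayley hM
  have hstep : (W - T * W * Tᵀ).PosSemidef := by
    rw [sub_cayley_conj hu hT, ← conjTranspose_eq_transpose_of_trivial]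
    exact (hQ.mul_mul_conjTranspose_same _).smul zero_le_two
  have hpow : ∀ k : ℕ, (W - T ^ k * W * (T ^ k)ᵀ).PosSemidef := by
    intro k
    induction k with
    | zero => simpa using PosSemidef.zero
    | succ k ih =>
      have h : W - T ^ (k + 1) * W * (T ^ (k + 1))ᵀ
          = (W - T ^ k * W * (T ^ k)ᵀ) + T ^ k * (W - T * W * Tᵀ) * (T ^ k)ᵀ := by
        rw [pow_succ, transpose_mul]
        noncomm_ring
      rw [h]
      refine ih.add ?_
      rw [← conjTranspose_eq_transpose_of_trivial (T ^ k)]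
      exact hstep.mul_mul_conjTranspose_same _
  refine .of_dotProduct_mulVec_nonneg
    (by rwa [IsHermitian, conjTranspose_eq_transpose_of_trivial]) fun x => ?_
  have hc : Continuous fun X : Matrix ι ι ℝ => star x ⬝ᵥ ((W - X) *ᵥ x) := by fun_prop
  have ht := (hc.tendsto 0).comp (tendsto_pow_conj hlim W)
  rw [sub_zero] at ht
  exact ge_of_tendsto' ht fun k => (hpow k).dotProduct_mulVec_nonneg x

theorem mulVec_eq_zero_of_lyapunov {M W : Matrix ι ι ℝ} {B : Matrix ι κ ℝ} (hW : Wᵀ = W)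
    (h : lyapunov M W = B * Bᵀ) {x : ι → ℝ} (hx : W *ᵥ x = 0) :
    Bᵀ *ᵥ x = 0 ∧ W *ᵥ (Mᵀ *ᵥ x) = 0 := by
  have hx' : x ᵥ* W = 0 := by rw [← mulVec_transpose, hW, hx]
  have hBB : W *ᵥ (Mᵀ *ᵥ x) = B *ᵥ (Bᵀ *ᵥ x) := by
    have := congrArg (· *ᵥ x) h
    simpa [lyapunov_apply, add_mulVec, ← mulVec_mulVec, hx] using this
  have hB : Bᵀ *ᵥ x = 0 := by
    rw [← dotProduct_self_eq_zero]
    calc (Bᵀ *ᵥ x) ⬝ᵥ (Bᵀ *ᵥ x) = x ⬝ᵥ (B *ᵥ (Bᵀ *ᵥ x)) := by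
          rw [dotProduct_mulVec x, mulVec_transpose]
      _ = 0 := by rw [← hBB, dotProduct_mulVec, hx', zero_dotProduct]
  exact ⟨hB, by rw [hBB, hB, mulVec_zero]⟩

theorem pos_re_of_mem_spectrum_add_smul_one {A : Matrix ι ι ℝ}
    (heig : ∀ μ ∈ spectrum ℂ (A.map Complex.ofReal), μ.re = 0) {c : ℝ} (hc : 0 < c) :
    ∀ μ ∈ spectrum ℂ ((A + c • (1 : Matrix ι ι ℝ)).map Complex.ofReal), 0 < μ.re := by
  intro μ hμ
  have h : (A + c • (1 : Matrix ι ι ℝ)).map Complex.ofReal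
      = algebraMap ℂ _ (c : ℂ) + A.map Complex.ofReal := by
    ext i j
    by_cases h : i = j <;> simp [h, algebraMap_matrix_apply, add_comm]
  rw [h, ← spectrum.singleton_add_eq, Set.singleton_add] at hμ
  obtain ⟨ν, hν, rfl⟩ := hμ
  simpa [heig ν hν] using hc

end Matrix

theorem Controllable.eq_zero {n m : ℕ} {A : Matrix (Fin n) (Fin n) ℝ}
    {B : Matrix (Fin n) (Fin m) ℝ} (h : Controllable A B) {x : Fin n → ℝ}
    (hx : ∀ k : ℕ, Bᵀ *ᵥ ((Aᵀ ^ k) *ᵥ x) = 0) : x = 0 := by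
  rw [← dotProduct_self_eq_zero]
  have hmem : x ∈ Submodule.span ℝ {v : Fin n → ℝ | ∃ (k : Fin n) (j : Fin m),
      v = (A ^ (k : ℕ)) *ᵥ (fun i => B i j)} := h ▸ Submodule.mem_top
  suffices ∀ y ∈ Submodule.span ℝ {v : Fin n → ℝ | ∃ (k : Fin n) (j : Fin m),
      v = (A ^ (k : ℕ)) *ᵥ (fun i => B i j)}, x ⬝ᵥ y = 0 from this x hmem
  intro y hy
  induction hy using Submodule.span_induction with
  | mem y hy =>
    obtain ⟨k, j, rfl⟩ := hy
    rw [dotProduct_mulVec, ← mulVec_transpose, transpose_pow, dotProduct_comm]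
    exact congrFun (hx k) j
  | zero => exact dotProduct_zero x
  | add y z _ _ hy hz => rw [dotProduct_add, hy, hz, add_zero]
  | smul c y _ hy => rw [dotProduct_smul, hy, smul_zero]

/-- Lemma 3 (existence/uniqueness part): under Assumption 2, for every `γ > 0` the Lyapunov
equation `W(A + (γ/2)I)ᵀ + (A + (γ/2)I)W = BBᵀ` has a unique solution, which is symmetric
positive definite. -/
theorem stmt_6 {n m : ℕ}
    (A : Matrix (Fin n) (Fin n) ℝ) (B : Matrix (Fin n) (Fin m) ℝ)
    (hctrb : Controllable A B)
    (heig : ∀ μ ∈ spectrum ℂ (A.map Complex.ofReal), μ.re = 0) :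
    ∀ γ : ℝ, 0 < γ →
      ∃ W : Matrix (Fin n) (Fin n) ℝ,
        (W * (A + (γ / 2) • (1 : Matrix (Fin n) (Fin n) ℝ))ᵀ
          + (A + (γ / 2) • (1 : Matrix (Fin n) (Fin n) ℝ)) * W = B * Bᵀ) ∧
        W.PosDef ∧
        ∀ W' : Matrix (Fin n) (Fin n) ℝ,
          W' * (A + (γ / 2) • (1 : Matrix (Fin n) (Fin n) ℝ))ᵀ
            + (A + (γ / 2) • (1 : Matrix (Fin n) (Fin n) ℝ)) * W' = B * Bᵀ → W' = W := by
  intro γ hγ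
  set M := A + (γ / 2) • (1 : Matrix (Fin n) (Fin n) ℝ) with hMdef
  have hM := pos_re_of_mem_spectrum_add_smul_one heig (half_pos hγ)
  have hinj := lyapunov_injective hM
  obtain ⟨W, hW⟩ := LinearMap.injective_iff_surjective.1 hinj (B * Bᵀ)
  have hpsd : W.PosSemidef := by
    refine posSemidef_of_lyapunov hM ?_
    rw [hW]
    simpa using posSemidef_self_mul_conjTranspose B
  have hsymm : Wᵀ = W := by
    simpa [IsHermitian, conjTranspose_eq_transpose_of_trivial] using hpsd.isHermitian
  refine ⟨W, hW, .of_dotProduct_mulVec_pos hpsd.isHermitian fun x hx => ?_,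
    fun W' hW' => hinj (hW'.trans hW.symm)⟩
  refine (hpsd.dotProduct_mulVec_nonneg x).lt_of_ne' fun h0 => hx (hctrb.eq_zero fun k => ?_)
  have hker : ∀ k : ℕ, W *ᵥ ((Aᵀ ^ k) *ᵥ x) = 0 := by
    intro k
    induction k with
    | zero => simpa using (hpsd.dotProduct_mulVec_zero_iff x).1 h0
    | succ k ih =>
      have h := (mulVec_eq_zero_of_lyapunov hsymm hW ih).2
      simpa [hMdef, add_mulVec, mulVec_add, smul_mulVec, mulVec_smul, ih, pow_succ',
        ← mulVec_mulVec] using h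
  exact (mulVec_eq_zero_of_lyapunov hsymm hW (hker k)).1
end

section
/- Let A ∈ ℝ^{n×n}, B ∈ ℝ^{n×m} and γ > 0. If W ∈ ℝ^{n×n} is symmetric positive definite (hence invertible) and satisfies the Lyapunov equation W(A + (γ/2)Iₙ)ᵀ + (A + (γ/2)Iₙ)W = BBᵀ, then P = W⁻¹ is symmetric positive definite and satisfies the parametric algebraic Riccati equation AᵀP + PA − PBBᵀP = −γP. -/
open Matrix MeasureTheory Filter Topology

/-- If `W ≻ 0` solves the Lyapunov equation `W(A + (γ/2)I)ᵀ + (A + (γ/2)I)W = BBᵀ`,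
then `P = W⁻¹ ≻ 0` solves the parametric ARE `AᵀP + PA − PBBᵀP = −γP`. -/
theorem stmt_7 {n m : ℕ}
    (A : Matrix (Fin n) (Fin n) ℝ) (B : Matrix (Fin n) (Fin m) ℝ) (γ : ℝ) (hγ : 0 < γ)
    (W : Matrix (Fin n) (Fin n) ℝ) (hW : W.PosDef)
    (hLyap : W * (A + (γ / 2) • (1 : Matrix (Fin n) (Fin n) ℝ))ᵀ
      + (A + (γ / 2) • (1 : Matrix (Fin n) (Fin n) ℝ)) * W = B * Bᵀ)
    (P : Matrix (Fin n) (Fin n) ℝ) (hP : P = W⁻¹) :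
    P.PosDef ∧ Aᵀ * P + P * A - P * B * Bᵀ * P = -(γ • P) := by
  subst hP
  refine ⟨hW.inv, ?_⟩
  have hdet : IsUnit W.det := (Matrix.isUnit_iff_isUnit_det W).mp hW.isUnit
  have hquad : ∀ C : Matrix (Fin n) (Fin n) ℝ,
      W⁻¹ * (W * Cᵀ + C * W) * W⁻¹ = Cᵀ * W⁻¹ + W⁻¹ * C := by
    intro C
    rw [Matrix.mul_add, Matrix.add_mul, Matrix.nonsing_inv_mul_cancel_left _ _ hdet,
      ← Matrix.mul_assoc W⁻¹ C W, Matrix.mul_nonsing_inv_cancel_right _ _ hdet]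
  rw [Matrix.mul_assoc W⁻¹ B, ← hLyap, hquad]
  simp only [transpose_add, transpose_smul, transpose_one, Matrix.add_mul, Matrix.mul_add,
    Matrix.smul_mul, Matrix.mul_smul, Matrix.one_mul, Matrix.mul_one]
  module
end

section
/- Let A ∈ ℝ^{n×n}, B ∈ ℝ^{n×m}, γ > 0, and suppose every eigenvalue of A (viewed as a complex matrix) has zero real part. If P ∈ ℝ^{n×n} is symmetric positive definite and satisfies the parametric ARE AᵀP + PA − PBBᵀP = −γP, and F = −BᵀP, then A + BF is Hurwitz: every eigenvalue of A + BF (viewed as a complex matrix) has negative real part (indeed real part equal to −γ plus the real part of an eigenvalue of A, hence equal to −γ). -/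
open Matrix MeasureTheory Filter Topology

/-- The parametric ARE makes `-(γ + μ)` an eigenvalue of `A` for every closed-loop
eigenvalue `μ`. -/
theorem neg_add_mem_spectrum_of_parametric_are {n m : ℕ}
    {A P : Matrix (Fin n) (Fin n) ℝ} {B : Matrix (Fin n) (Fin m) ℝ} {γ : ℝ}
    (hP : IsUnit P.det)
    (hare : Aᵀ * P + P * A - P * B * Bᵀ * P = -(γ • P)) {μ : ℂ}
    (hμ : μ ∈ spectrum ℂ ((A + B * -(Bᵀ * P)).map Complex.ofReal)) :
    -(γ + μ) ∈ spectrum ℂ (A.map Complex.ofReal) := by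
  have hreal : P * (A + B * -(Bᵀ * P)) = -((Aᵀ + γ • 1) * P) := by
    have h : P * (A + B * -(Bᵀ * P)) = P * A - P * B * Bᵀ * P := by
      simp only [mul_add, Matrix.mul_neg, Matrix.mul_assoc, sub_eq_add_neg]
    rw [h, add_mul, smul_mul_assoc, one_mul, neg_add, ← hare]
    abel
  have hcomplex := congrArg (fun M => Complex.ofRealHom.mapMatrix M) hreal
  simp only [map_mul, map_neg] at hcomplex
  rw [spectrum.mem_iff, Matrix.isUnit_iff_isUnit_det, isUnit_iff_ne_zero, not_not] at hμ ⊢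
  set Ac := Complex.ofRealHom.mapMatrix A with hAc
  set Pc := Complex.ofRealHom.mapMatrix P with hPc
  set C := Complex.ofRealHom.mapMatrix (A + B * -(Bᵀ * P)) with hC
  change (algebraMap ℂ (Matrix (Fin n) (Fin n) ℂ) μ - C).det = 0 at hμ
  change (algebraMap ℂ (Matrix (Fin n) (Fin n) ℂ) (-(γ + μ)) - Ac).det = 0
  have hshift : Complex.ofRealHom.mapMatrix (Aᵀ + γ • (1 : Matrix (Fin n) (Fin n) ℝ)) =
      Acᵀ + (γ : ℂ) • 1 := by
    ext i j
    by_cases hij : i = j <;> simp [hAc, hij]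
  rw [hshift] at hcomplex
  have hconj : Pc * (algebraMap ℂ _ μ - C) =
      -((algebraMap ℂ _ (-(γ + μ)) - Ac)ᵀ * Pc) := by
    rw [mul_sub, hcomplex]
    simp only [Algebra.algebraMap_eq_smul_one, transpose_sub, transpose_add, transpose_neg,
      transpose_smul, transpose_one, neg_mul, sub_mul, add_mul, smul_mul_assoc, one_mul, mul_smul_comm,
      mul_one, neg_smul, add_smul]
    abel
  have hdet := congrArg Matrix.det hconj
  rw [det_mul, hμ, mul_zero, det_neg, det_mul, det_transpose] at hdet
  have hPdet : Pc.det ≠ 0 := by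
    rw [hPc, ← RingHom.map_det]
    exact (hP.map Complex.ofRealHom).ne_zero
  simpa [hPdet] using hdet.symm

/-- If all eigenvalues of `A` lie on the imaginary axis and `P ≻ 0` solves the parametric ARE
`AᵀP + PA − PBBᵀP = −γP` with `γ > 0`, then `A + BF` with `F = −BᵀP` is Hurwitz. -/
theorem stmt_8 {n m : ℕ}
    (A : Matrix (Fin n) (Fin n) ℝ) (B : Matrix (Fin n) (Fin m) ℝ) (γ : ℝ) (hγ : 0 < γ)
    (heig : ∀ μ ∈ spectrum ℂ (A.map Complex.ofReal), μ.re = 0)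
    (P : Matrix (Fin n) (Fin n) ℝ) (hP : P.PosDef)
    (hare : Aᵀ * P + P * A - P * B * Bᵀ * P = -(γ • P))
    (F : Matrix (Fin m) (Fin n) ℝ) (hF : F = -(Bᵀ * P)) :
    ∀ μ ∈ spectrum ℂ ((A + B * F).map Complex.ofReal), μ.re < 0 := by
  intro μ hμ
  subst hF
  have h := heig _ (neg_add_mem_spectrum_of_parametric_are hP.det_pos.ne'.isUnit hare hμ)
  simp only [Complex.neg_re, Complex.add_re, Complex.ofReal_re] at h
  linarith
end

section
/- Let A ∈ ℝ^{n×n}, B ∈ ℝ^{n×m}, γ > 0, and suppose every eigenvalue of A (viewed as a complex matrix) has zero real part. If P ∈ ℝ^{n×n} is symmetric positive definite and satisfies the parametric ARE AᵀP + PA − PBBᵀP = −γP, then tr(BᵀPB) = nγ. -/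
open Matrix MeasureTheory Filter Topology

/-- A real matrix whose complex eigenvalues are all purely imaginary has trace zero. -/
theorem Matrix.trace_eq_zero_of_spectrum_re_eq_zero {ι : Type*} [Fintype ι] [DecidableEq ι]
    (A : Matrix ι ι ℝ)
    (h : ∀ μ ∈ spectrum ℂ (A.map Complex.ofReal), μ.re = 0) : A.trace = 0 := by
  have htr : (A.map Complex.ofReal).trace = (A.trace : ℂ) := by
    simp [Matrix.trace]
  rw [← Complex.ofReal_re A.trace, ← htr, Matrix.trace_eq_sum_roots_charpoly]
  change Complex.reAddGroupHom _ = 0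
  rw [map_multiset_sum]
  refine Multiset.sum_eq_zero fun x hx => ?_
  obtain ⟨μ, hμ, rfl⟩ := Multiset.mem_map.1 hx
  exact h μ (Matrix.mem_spectrum_of_isRoot_charpoly (Polynomial.isRoot_of_mem_roots hμ))

/-- If all eigenvalues of `A` lie on the imaginary axis and `P ≻ 0` solves the parametric ARE
`AᵀP + PA − PBBᵀP = −γP` with `γ > 0`, then `tr(BᵀPB) = nγ`. -/
theorem stmt_9 {n m : ℕ}
    (A : Matrix (Fin n) (Fin n) ℝ) (B : Matrix (Fin n) (Fin m) ℝ) (γ : ℝ) (hγ : 0 < γ)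
    (heig : ∀ μ ∈ spectrum ℂ (A.map Complex.ofReal), μ.re = 0)
    (P : Matrix (Fin n) (Fin n) ℝ) (hP : P.PosDef)
    (hare : Aᵀ * P + P * A - P * B * Bᵀ * P = -(γ • P)) :
    Matrix.trace (Bᵀ * P * B) = (n : ℝ) * γ := by
  have htrA : A.trace = 0 := A.trace_eq_zero_of_spectrum_re_eq_zero heig
  have hdet : IsUnit P.det := (Matrix.isUnit_iff_isUnit_det P).1 hP.isUnit
  have h := congrArg (fun M => Matrix.trace (M * P⁻¹)) hare
  simp only [Matrix.sub_mul, Matrix.add_mul, Matrix.neg_mul, Matrix.smul_mul, Matrix.trace_sub,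
    Matrix.trace_add, Matrix.trace_neg, Matrix.trace_smul,
    Matrix.mul_nonsing_inv_cancel_right _ _ hdet, Matrix.mul_nonsing_inv _ hdet,
    Matrix.trace_one, Fintype.card_fin, smul_eq_mul] at h
  rw [Matrix.trace_mul_comm (P * A), Matrix.nonsing_inv_mul_cancel_left _ _ hdet,
    Matrix.trace_transpose, htrA] at h
  rw [Matrix.mul_assoc, Matrix.trace_mul_comm]
  linarith
end

section
/- Let A ∈ ℝ^{n×n}, B ∈ ℝ^{n×m} satisfy Assumption 2 (the pair (A,B) is controllable and every eigenvalue of A has zero real part), and let P : (0,∞) → ℝ^{n×n} be a function such that for every γ > 0, P(γ) is symmetric positive definite and satisfies the parametric ARE AᵀP(γ) + P(γ)A − P(γ)BBᵀP(γ) = −γP(γ). Then P(γ) → 0 as γ → 0⁺. -/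
open Matrix MeasureTheory Filter Topology

open scoped ComplexOrder

/-- Every matrix over a field has a generalized inverse. -/
lemma Matrix.exists_mul_mul_eq_self {K ι : Type*} [Field K] [Fintype ι] [DecidableEq ι]
    (Q : Matrix ι ι K) : ∃ G : Matrix ι ι K, Q * G * Q = Q := by
  obtain ⟨s, hs⟩ := (toLin' Q).rangeRestrict.exists_rightInverse_of_surjective
    (LinearMap.range_rangeRestrict _)
  obtain ⟨g, hg⟩ := LinearMap.exists_extend s
  refine ⟨LinearMap.toMatrix' g, toLin'.injective (LinearMap.ext fun x => ?_)⟩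
  have h1 : g (toLin' Q x) = s ((toLin' Q).rangeRestrict x) :=
    LinearMap.congr_fun hg ((toLin' Q).rangeRestrict x)
  have h2 := congrArg Subtype.val (LinearMap.congr_fun hs ((toLin' Q).rangeRestrict x))
  rw [toLin'_mul, toLin'_mul, toLin'_toMatrix']
  rw [LinearMap.comp_apply, LinearMap.comp_apply, h1]
  exact h2

/-- If the range of `Q ≠ 0` is invariant under `M`, then it contains an eigenvector of `M`. -/
lemma Matrix.exists_eigenvector_mem_range {ι : Type*} [Fintype ι] [DecidableEq ι]
    {M Q X : Matrix ι ι ℂ} (h : M * Q = Q * X) (hQ : Q ≠ 0) :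
    ∃ (μ : ℂ) (v : ι → ℂ), Q *ᵥ v ≠ 0 ∧ M *ᵥ (Q *ᵥ v) = μ • (Q *ᵥ v) := by
  have hinv : ∀ w ∈ LinearMap.range (toLin' Q), toLin' M w ∈ LinearMap.range (toLin' Q) := by
    rintro _ ⟨v, rfl⟩
    exact ⟨X *ᵥ v, by simp [h]⟩
  have : Nontrivial (LinearMap.range (toLin' Q)) := by
    rw [Submodule.nontrivial_iff_ne_bot, Ne, LinearMap.range_eq_bot]
    simpa using hQ
  obtain ⟨μ, hμ⟩ := Module.End.exists_eigenvalue ((toLin' M).restrict hinv)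
  obtain ⟨⟨_, v, rfl⟩, hw, hw0⟩ := hμ.exists_hasEigenvector
  rw [Module.End.mem_eigenspace_iff] at hw
  refine ⟨μ, v, fun h0 => hw0 (Subtype.ext (by simpa using h0)), ?_⟩
  simpa using congrArg Subtype.val hw

lemma Matrix.re_eq_zero_of_conjTranspose_mulVec {ι : Type*} [Fintype ι] [DecidableEq ι]
    {A : Matrix ι ι ℂ} (hA : ∀ μ ∈ spectrum ℂ A, μ.re = 0) {μ : ℂ} {w : ι → ℂ} (hw : w ≠ 0)
    (h : Aᴴ *ᵥ w = μ • w) : μ.re = 0 := by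
  have hμ : star μ ∈ spectrum ℂ A := by
    rw [spectrum.mem_iff, Algebra.algebraMap_eq_smul_one, ← isUnit_star, star_sub, star_smul,
      star_star, star_one, star_eq_conjTranspose]
    intro hu
    refine hw (mulVec_injective_iff_isUnit.2 hu ?_)
    simp [sub_mulVec, h, smul_mulVec]
  simpa using hA _ hμ

/-- A positive semidefinite solution of a Lyapunov-type equation whose right-hand side controls
`Q B Bᴴ Q` vanishes, provided `A` has imaginary spectrum and no eigenvector of `Aᴴ` is killed
by `Bᴴ`. -/
lemma Matrix.PosSemidef.eq_zero_of_lyapunov {ι κ : Type*} [Fintype ι] [DecidableEq ι] [Fintype κ]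
    {A Q S : Matrix ι ι ℂ} {B : Matrix ι κ ℂ} {c : ℂ}
    (hA : ∀ μ ∈ spectrum ℂ A, μ.re = 0)
    (hB : ∀ (μ : ℂ) (w : ι → ℂ), Aᴴ *ᵥ w = μ • w → Bᴴ *ᵥ w = 0 → w = 0)
    (hQ : Q.PosSemidef) (hS : S.PosSemidef) (h : Aᴴ * Q + Q * A = S)
    (hc : c • S = Q * B * Bᴴ * Q) : Q = 0 := by
  have hker : ∀ x, Q *ᵥ x = 0 → Q *ᵥ (A *ᵥ x) = 0 := by
    intro x hx
    have hxQ : star x ᵥ* Q = 0 := by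
      rw [← hQ.isHermitian.eq, ← star_mulVec, hx, star_zero]
    have hSx : S *ᵥ x = 0 := by
      rw [← hS.dotProduct_mulVec_zero_iff, ← h, add_mulVec, ← mulVec_mulVec, ← mulVec_mulVec, hx,
        mulVec_zero, zero_add, dotProduct_mulVec, hxQ, zero_dotProduct]
    simpa [← h, add_mulVec, ← mulVec_mulVec, hx] using hSx
  obtain ⟨G, hG⟩ := exists_mul_mul_eq_self Q
  have hQA : Q * A = Q * A * G * Q := by
    refine toLin'.injective (LinearMap.ext fun x => ?_)
    have h0 : Q *ᵥ (x - G *ᵥ (Q *ᵥ x)) = 0 := by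
      rw [mulVec_sub, mulVec_mulVec, mulVec_mulVec, hG, sub_self]
    have h1 := hker _ h0
    rw [mulVec_sub, mulVec_sub, sub_eq_zero] at h1
    simpa [← mulVec_mulVec] using h1
  have hAQ : Aᴴ * Q = Q * (Q * A * G)ᴴ := by
    have := congrArg (fun M => Mᴴ) hQA
    rwa [conjTranspose_mul, conjTranspose_mul (Q * A * G), hQ.isHermitian.eq] at this
  by_contra hQ0
  obtain ⟨μ, v, hw, hμ⟩ := exists_eigenvector_mem_range hAQ hQ0
  have hre := re_eq_zero_of_conjTranspose_mulVec hA hw hμ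
  have hvQ : star v ᵥ* Q = star (Q *ᵥ v) := by rw [star_mulVec, hQ.isHermitian.eq]
  have hSv : S *ᵥ v = 0 := by
    have hQAv : star v ⬝ᵥ ((Q * A) *ᵥ v) = star μ * (star v ⬝ᵥ (Q *ᵥ v)) := by
      rw [← mulVec_mulVec, dotProduct_mulVec, hvQ, dotProduct_mulVec,
        ← conjTranspose_conjTranspose A, ← star_mulVec, hμ, star_smul, smul_dotProduct, ← hvQ,
        ← dotProduct_mulVec, smul_eq_mul]
    rw [← hS.dotProduct_mulVec_zero_iff, ← h, add_mulVec, dotProduct_add, hQAv, ← mulVec_mulVec, hμ,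
      dotProduct_smul, smul_eq_mul, ← add_mul]
    have : μ + star μ = 0 := Complex.ext (by simp [hre]) (by simp)
    rw [this, zero_mul]
  refine hw (hB μ _ hμ ?_)
  rw [← dotProduct_star_self_eq_zero, star_mulVec, conjTranspose_conjTranspose]
  have h2 : star v ⬝ᵥ ((Q * B * Bᴴ * Q) *ᵥ v) = 0 := by
    rw [← hc, smul_mulVec, hSv, smul_zero, dotProduct_zero]
  rwa [Matrix.mul_assoc, Matrix.mul_assoc, ← mulVec_mulVec, dotProduct_mulVec, hvQ,
    ← mulVec_mulVec, ← mulVec_mulVec, dotProduct_mulVec] at h2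

lemma Controllable.eq_zero_of_eigenvector {n m : ℕ} {A : Matrix (Fin n) (Fin n) ℝ}
    {B : Matrix (Fin n) (Fin m) ℝ} (h : Controllable A B) {μ : ℂ} {w : Fin n → ℂ}
    (hA : (A.map Complex.ofReal)ᴴ *ᵥ w = μ • w) (hB : (B.map Complex.ofReal)ᴴ *ᵥ w = 0) :
    w = 0 := by
  have hcT : ∀ {k l : ℕ} (M : Matrix (Fin k) (Fin l) ℝ),
      (M.map Complex.ofReal)ᴴ = Mᵀ.map Complex.ofReal := by
    intro k l M
    ext
    simp
  rw [hcT] at hA hB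
  let φ : (Fin n → ℝ) →ₗ[ℝ] ℂ :=
    { toFun := fun v => w ⬝ᵥ (fun i => (v i : ℂ))
      map_add' := fun x y => by simp [dotProduct, mul_add, Finset.sum_add_distrib]
      map_smul' := fun a x => by simp [dotProduct, Finset.mul_sum, mul_left_comm] }
  have hφA : ∀ v, φ (A *ᵥ v) = μ * φ v := by
    intro v
    have : (fun i => ((A *ᵥ v) i : ℂ)) = A.map Complex.ofReal *ᵥ (fun i => (v i : ℂ)) := by
      ext i
      simp [mulVec, dotProduct]
    change w ⬝ᵥ _ = μ * (w ⬝ᵥ _)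
    rw [this, dotProduct_mulVec, ← mulVec_transpose, ← transpose_map, hA, smul_dotProduct,
      smul_eq_mul]
  have hφ : φ = 0 := by
    refine LinearMap.ext_on h ?_
    rintro _ ⟨k, j, rfl⟩
    have hk : ∀ k : ℕ, φ (A ^ k *ᵥ fun i => B i j) = 0 := by
      intro k
      induction k with
      | zero =>
        have := congrFun hB j
        simpa [φ, mulVec, dotProduct, mul_comm] using this
      | succ k ih => rw [pow_succ', ← mulVec_mulVec, hφA, ih, mul_zero]
    exact hk k
  ext i
  have := LinearMap.congr_fun hφ (Pi.single i 1)
  simpa [φ, dotProduct, Pi.single_apply, apply_ite Complex.ofReal] using this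

lemma Matrix.PosSemidef.map_ofReal {ι : Type*} [Fintype ι] {Q : Matrix ι ι ℝ}
    (hQ : Q.PosSemidef) : (Q.map Complex.ofReal).PosSemidef := by
  classical
  obtain ⟨C, rfl⟩ : ∃ C, Q = Cᴴ * C := by
    open scoped MatrixOrder in
    exact CStarAlgebra.nonneg_iff_eq_star_mul_self.1 hQ.nonneg
  have : (Cᴴ * C).map Complex.ofReal = (C.map Complex.ofReal)ᴴ * C.map Complex.ofReal := by
    ext
    simp [mul_apply]
  rw [this]
  exact posSemidef_conjTranspose_mul_self _

lemma Matrix.PosSemidef.of_tendsto {α ι : Type*} [Fintype ι] {l : Filter α} [l.NeBot]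
    {F : α → Matrix ι ι ℝ} {M : Matrix ι ι ℝ} (hF : Tendsto F l (𝓝 M))
    (h : ∀ᶠ a in l, (F a).PosSemidef) : M.PosSemidef := by
  refine .of_dotProduct_mulVec_nonneg ?_ fun x => ?_
  · refine tendsto_nhds_unique_of_eventuallyEq (f := fun a => (F a)ᴴ) (g := F) ?_ hF ?_
    · exact ((continuous_id.matrix_conjTranspose).tendsto M).comp hF
    · filter_upwards [h] with a ha using ha.isHermitian.eq
  · have hc : Continuous fun N : Matrix ι ι ℝ => star x ⬝ᵥ (N *ᵥ x) := by fun_prop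
    refine ge_of_tendsto ((hc.tendsto M).comp hF) ?_
    filter_upwards [h] with a ha using ha.dotProduct_mulVec_nonneg x

/-- Real form of `Matrix.PosSemidef.eq_zero_of_lyapunov` for a controllable pair. -/
lemma Controllable.eq_zero_of_lyapunov {n m : ℕ} {A : Matrix (Fin n) (Fin n) ℝ}
    {B : Matrix (Fin n) (Fin m) ℝ} (hctrb : Controllable A B)
    (heig : ∀ μ ∈ spectrum ℂ (A.map Complex.ofReal), μ.re = 0)
    {Q S : Matrix (Fin n) (Fin n) ℝ} {c : ℝ} (hQ : Q.PosSemidef) (hS : S.PosSemidef)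
    (h : Aᵀ * Q + Q * A = S) (hc : c • S = Q * B * Bᵀ * Q) : Q = 0 := by
  have hmap : Q.map Complex.ofReal = 0 := by
    refine hQ.map_ofReal.eq_zero_of_lyapunov (c := c) heig
      (fun μ w => hctrb.eq_zero_of_eigenvector) hS.map_ofReal (B := B.map Complex.ofReal) ?_ ?_
    · rw [← h]
      ext
      simp [mul_apply]
    · have := congrArg (fun M => M.map Complex.ofReal) hc
      ext i j
      simpa [mul_apply] using congrFun (congrFun this i) j
  ext i j
  simpa using congrFun (congrFun hmap i) j

/-- Under Assumption 2, if `P(γ) ≻ 0` solves the parametric ARE for every `γ > 0`,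
then `P(γ) → 0` as `γ → 0⁺`. -/
theorem stmt_11 {n m : ℕ}
    (A : Matrix (Fin n) (Fin n) ℝ) (B : Matrix (Fin n) (Fin m) ℝ)
    (hctrb : Controllable A B)
    (heig : ∀ μ ∈ spectrum ℂ (A.map Complex.ofReal), μ.re = 0)
    (P : ℝ → Matrix (Fin n) (Fin n) ℝ)
    (hP : ∀ γ : ℝ, 0 < γ → (P γ).PosDef ∧
      Aᵀ * P γ + P γ * A - P γ * B * Bᵀ * P γ = -(γ • P γ)) :
    Tendsto P (nhdsWithin 0 (Set.Ioi 0)) (nhds (0 : Matrix (Fin n) (Fin n) ℝ)) := by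
  let _ := Matrix.normedAddCommGroup (m := Fin n) (n := Fin n) (α := ℝ)
  let _ := Matrix.normedSpace (m := Fin n) (n := Fin n) (R := ℝ) (α := ℝ)
  have : ProperSpace (Matrix (Fin n) (Fin n) ℝ) := FiniteDimensional.proper_real _
  -- Rescale `P` into the unit ball.
  let c : ℝ → ℝ := fun γ => (max 1 ‖P γ‖)⁻¹
  let Q : ℝ → Matrix (Fin n) (Fin n) ℝ := fun γ => c γ • P γ
  have hmax : ∀ γ, 0 < max 1 ‖P γ‖ := fun γ => lt_max_of_lt_left one_pos
  have hc0 : ∀ γ, 0 < c γ := fun γ => inv_pos.2 (hmax γ)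
  have hc1 : ∀ γ, c γ ≤ 1 := fun γ => inv_le_one_of_one_le₀ (le_max_left _ _)
  have hQnorm : ∀ γ, ‖Q γ‖ = c γ * ‖P γ‖ := fun γ => by
    rw [norm_smul, Real.norm_of_nonneg (hc0 γ).le]
  have hQ1 : ∀ γ, ‖Q γ‖ ≤ 1 := fun γ => by
    rw [hQnorm, inv_mul_le_iff₀ (hmax γ), mul_one]
    exact le_max_right _ _
  have hQpsd : ∀ γ, 0 < γ → (Q γ).PosSemidef := fun γ hγ =>
    (hP γ hγ).1.posSemidef.smul (hc0 γ).le
  have hare : ∀ γ, 0 < γ →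
      Aᵀ * Q γ + Q γ * A + γ • Q γ = c γ • (P γ * B * Bᵀ * P γ) := fun γ hγ => by
    have h := (hP γ hγ).2
    rw [sub_eq_iff_eq_add, neg_add_eq_sub, eq_sub_iff_add_eq] at h
    rw [← h]
    simp only [Q, Matrix.mul_smul, Matrix.smul_mul, smul_add, smul_comm γ]
  have hQlim : Tendsto Q (𝓝[>] 0) (𝓝 0) := by
    rw [tendsto_iff_ultrafilter]
    intro g hg
    have hpos : ∀ᶠ γ in (g : Filter ℝ), 0 < γ := hg self_mem_nhdsWithin
    have hγ : Tendsto (fun γ : ℝ => γ) g (𝓝 0) := hg.trans nhdsWithin_le_nhds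
    obtain ⟨Q₀, -, hQ₀⟩ :=
      (isCompact_closedBall (0 : Matrix (Fin n) (Fin n) ℝ) 1).ultrafilter_le_nhds' (g.map Q)
      (Filter.mem_map.2 (Filter.Eventually.of_forall fun γ => mem_closedBall_zero_iff.2 (hQ1 γ)))
    obtain ⟨c₀, -, hc₀⟩ := (isCompact_Icc (a := (0 : ℝ)) (b := 1)).ultrafilter_le_nhds'
      (g.map c) (Filter.mem_map.2 (Filter.Eventually.of_forall fun γ => ⟨(hc0 γ).le, hc1 γ⟩))
    replace hQ₀ : Tendsto Q g (𝓝 Q₀) := hQ₀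
    replace hc₀ : Tendsto c g (𝓝 c₀) := hc₀
    have hS : Tendsto (fun γ => Aᵀ * Q γ + Q γ * A + γ • Q γ) g (𝓝 (Aᵀ * Q₀ + Q₀ * A)) := by
      have hcont : Continuous fun p : ℝ × Matrix (Fin n) (Fin n) ℝ =>
          Aᵀ * p.2 + p.2 * A + p.1 • p.2 := by fun_prop
      simpa [Function.comp_def] using (hcont.tendsto (0, Q₀)).comp (hγ.prodMk_nhds hQ₀)
    have hQBQ : Tendsto (fun γ => Q γ * B * Bᵀ * Q γ) g (𝓝 (Q₀ * B * Bᵀ * Q₀)) := by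
      have hcont : Continuous fun M : Matrix (Fin n) (Fin n) ℝ => M * B * Bᵀ * M := by fun_prop
      exact (hcont.tendsto Q₀).comp hQ₀
    have hQ₀psd : Q₀.PosSemidef := .of_tendsto hQ₀ (hpos.mono hQpsd)
    have hSpsd : (Aᵀ * Q₀ + Q₀ * A).PosSemidef := by
      refine .of_tendsto hS (hpos.mono fun γ hγ => ?_)
      rw [hare γ hγ]
      refine PosSemidef.smul ?_ (hc0 γ).le
      have hPt : (P γ)ᵀ = P γ := by simpa using (hP γ hγ).1.isHermitian.eq
      simpa [hPt, Matrix.mul_assoc] using posSemidef_conjTranspose_mul_self (Bᵀ * P γ)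
    have hlim : c₀ • (Aᵀ * Q₀ + Q₀ * A) = Q₀ * B * Bᵀ * Q₀ := by
      refine tendsto_nhds_unique_of_eventuallyEq (hc₀.smul hS) hQBQ (hpos.mono fun γ hγ => ?_)
      beta_reduce
      rw [hare γ hγ]
      simp only [Q, Matrix.mul_smul, Matrix.smul_mul]
    rwa [hctrb.eq_zero_of_lyapunov heig hQ₀psd hSpsd rfl hlim] at hQ₀
  refine hQlim.congr' ?_
  have hsmall : ∀ᶠ γ in 𝓝[>] (0 : ℝ), ‖Q γ‖ < 1 :=
    (tendsto_zero_iff_norm_tendsto_zero.1 hQlim).eventually_lt_const one_pos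
  filter_upwards [hsmall] with γ hγ
  have hP1 : ‖P γ‖ ≤ 1 := by
    by_contra! hlt
    rw [hQnorm, inv_mul_lt_iff₀ (hmax γ), mul_one, max_eq_right hlt.le] at hγ
    exact lt_irrefl _ hγ
  simp [Q, c, max_eq_left hP1]
end

section
/- Let A ∈ ℝ^{n×n}, B ∈ ℝ^{n×m}, γ > 0, let P ∈ ℝ^{n×n} be symmetric and satisfy the parametric ARE AᵀP + PA − PBBᵀP = −γP, and set F = −BᵀP. Let λ ∈ ℂ with Re λ > 0 and let μ ∈ ℝ with μ ≥ 1/Re λ, and set 𝓕 = λμF ∈ ℂ^{m×n}. Then, viewing A, B, P as complex matrices, (A + B𝓕)ᴴ P + P (A + B𝓕) ≤ −γP − PBBᵀP in the sense that the Hermitian matrix (−γP − PBBᵀP) − ((A + B𝓕)ᴴ P + P (A + B𝓕)) is positive semidefinite. -/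
open Matrix MeasureTheory Filter Topology
open scoped ComplexOrder

theorem conjTranspose_map_ofReal {p q : Type*} (M : Matrix p q ℝ) :
    (M.map Complex.ofReal)ᴴ = Mᵀ.map Complex.ofReal := by
  ext i j
  simp

theorem map_ofReal_mul {p q r : Type*} [Fintype q] (M : Matrix p q ℝ) (N : Matrix q r ℝ) :
    (M * N).map Complex.ofReal = M.map Complex.ofReal * N.map Complex.ofReal :=
  Matrix.map_mul (f := Complex.ofRealHom)

/-- Inequality (71): with `F = −BᵀP`, `Re λ > 0`, `μ ≥ 1/Re λ` and `𝓕 = λμF`, one has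
`(A + B𝓕)ᴴ P + P (A + B𝓕) ≤ −γP − PBBᵀP` in the Loewner order on Hermitian matrices. -/
theorem stmt_16 {n m : ℕ}
    (A : Matrix (Fin n) (Fin n) ℝ) (B : Matrix (Fin n) (Fin m) ℝ) (γ : ℝ) (hγ : 0 < γ)
    (P : Matrix (Fin n) (Fin n) ℝ) (hsym : Pᵀ = P)
    (hare : Aᵀ * P + P * A - P * B * Bᵀ * P = -(γ • P))
    (F : Matrix (Fin m) (Fin n) ℝ) (hF : F = -(Bᵀ * P))
    (l : ℂ) (hl : 0 < l.re) (μ : ℝ) (hμ : 1 / l.re ≤ μ)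
    (𝓕 : Matrix (Fin m) (Fin n) ℂ) (h𝓕 : 𝓕 = (l * (μ : ℂ)) • (F.map Complex.ofReal)) :
    Matrix.PosSemidef
      (((-(γ • P) - P * B * Bᵀ * P).map Complex.ofReal) -
        ((A.map Complex.ofReal + B.map Complex.ofReal * 𝓕)ᴴ * (P.map Complex.ofReal)
          + (P.map Complex.ofReal) * (A.map Complex.ofReal + B.map Complex.ofReal * 𝓕))) := by
  have hc : 1 ≤ l.re * μ := by
    rw [div_le_iff₀ hl] at hμ
    linarith
  set G := P * B * Bᵀ * P with hG
  have hlyap : Aᵀ * P + P * A = G - γ • P := by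
    rw [sub_eq_iff_eq_add] at hare
    rw [hare]
    abel
  have hgram : G.map Complex.ofReal
      = ((Bᵀ * P).map Complex.ofReal)ᴴ * (Bᵀ * P).map Complex.ofReal := by
    rw [conjTranspose_map_ofReal, ← map_ofReal_mul, hG]
    simp [hsym, Matrix.mul_assoc]
  have hclosed : (A.map Complex.ofReal + B.map Complex.ofReal * 𝓕)ᴴ * P.map Complex.ofReal
      + P.map Complex.ofReal * (A.map Complex.ofReal + B.map Complex.ofReal * 𝓕)
      = (Aᵀ * P + P * A).map Complex.ofReal
        - (star (l * (μ : ℂ)) + l * (μ : ℂ)) • G.map Complex.ofReal := by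
    have hneg : F.map Complex.ofReal = -((Bᵀ * P).map Complex.ofReal) := by
      ext i j
      simp [hF]
    have hadd : (Aᵀ * P + P * A).map Complex.ofReal
        = (Aᵀ * P).map Complex.ofReal + (P * A).map Complex.ofReal := by
      ext i j
      simp
    rw [h𝓕, hneg, hadd, hG]
    simp only [conjTranspose_add, conjTranspose_mul, conjTranspose_smul, conjTranspose_neg,
      conjTranspose_map_ofReal, map_ofReal_mul, hsym, transpose_transpose, Matrix.add_mul, Matrix.mul_add,
      Matrix.mul_smul, Matrix.smul_mul, Matrix.mul_neg, Matrix.neg_mul, add_smul, smul_neg,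
      Matrix.mul_assoc]
    abel
  have hdiff : (-(γ • P) - G).map Complex.ofReal
      - ((Aᵀ * P + P * A).map Complex.ofReal
        - (star (l * (μ : ℂ)) + l * (μ : ℂ)) • G.map Complex.ofReal)
      = ((2 * (l.re * μ - 1) : ℝ) : ℂ) • G.map Complex.ofReal := by
    have hre : star (l * (μ : ℂ)) + l * (μ : ℂ) = ((2 * (l.re * μ) : ℝ) : ℂ) := by
      rw [add_comm, Complex.star_def, Complex.add_conj]
      simp
    rw [hlyap, hre]
    ext i j
    simp
    ring
  rw [hclosed, hdiff, hgram]
  refine (posSemidef_conjTranspose_mul_self _).smul ?_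
  rw [Complex.zero_le_real]
  linarith
end

section
/- Let A ∈ ℝ^{n×n}, B ∈ ℝ^{n×m}, γ > 0, let P ∈ ℝ^{n×n} be symmetric positive definite and satisfy the parametric ARE AᵀP + PA − PBBᵀP = −γP, and set F = −BᵀP. Suppose y : ℝ → ℝ^n and ρ : ℝ → ℝ^m are such that y is differentiable at t with ẏ(t) = (A+BF) y(t) + B ρ(t). Then the function V₁(s) = y(s)ᵀ P y(s) is differentiable at t and its derivative satisfies V̇₁(t) = −γ y(t)ᵀPy(t) − y(t)ᵀPBBᵀPy(t) + 2y(t)ᵀPBρ(t) ≤ −γ y(t)ᵀ P y(t) + ‖ρ(t)‖². -/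
open Matrix MeasureTheory Filter Topology

/-- The product rule for the dot product of vector-valued functions. -/
theorem HasDerivAt.dotProduct {n : ℕ} {u v : ℝ → Fin n → ℝ} {u' v' : Fin n → ℝ} {t : ℝ}
    (hu : HasDerivAt u u' t) (hv : HasDerivAt v v' t) :
    HasDerivAt (fun s => u s ⬝ᵥ v s) (u' ⬝ᵥ v t + u t ⬝ᵥ v') t := by
  rw [hasDerivAt_pi] at hu hv
  have h := HasDerivAt.fun_sum (u := Finset.univ) fun i _ => (hu i).fun_mul (hv i)
  simpa only [_root_.dotProduct, Finset.sum_add_distrib] using h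

/-- Multiplication by a constant matrix commutes with differentiation. -/
theorem HasDerivAt.const_mulVec {n k : ℕ} (M : Matrix (Fin k) (Fin n) ℝ) {u : ℝ → Fin n → ℝ}
    {u' : Fin n → ℝ} {t : ℝ} (hu : HasDerivAt u u' t) :
    HasDerivAt (fun s => M *ᵥ u s) (M *ᵥ u') t := by
  rw [hasDerivAt_pi] at hu ⊢
  intro i
  exact HasDerivAt.fun_sum (u := Finset.univ) fun j _ => (hu j).const_mul (M i j)

/-- A matrix can be moved across the dot product at the cost of a transpose. -/
theorem Matrix.dotProduct_mulVec_eq_transpose {n k : ℕ} (M : Matrix (Fin k) (Fin n) ℝ)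
    (u : Fin k → ℝ) (v : Fin n → ℝ) : u ⬝ᵥ (M *ᵥ v) = v ⬝ᵥ (Mᵀ *ᵥ u) := by
  rw [dotProduct_mulVec, ← mulVec_transpose, dotProduct_comm]

/-- Derivative of the Lyapunov function `V₁(t) = y(t)ᵀ P y(t)` along
`ẏ(t) = (A+BF) y(t) + B ρ(t)` with `F = −BᵀP` and `P` a positive definite solution of the
parametric ARE, together with the bound `V̇₁(t) ≤ −γ yᵀPy + ‖ρ(t)‖²`. -/
theorem stmt_17 {n m : ℕ}
    (A : Matrix (Fin n) (Fin n) ℝ) (B : Matrix (Fin n) (Fin m) ℝ) (γ : ℝ) (hγ : 0 < γ)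
    (P : Matrix (Fin n) (Fin n) ℝ) (hP : P.PosDef)
    (hare : Aᵀ * P + P * A - P * B * Bᵀ * P = -(γ • P))
    (F : Matrix (Fin m) (Fin n) ℝ) (hF : F = -(Bᵀ * P))
    (y : ℝ → Fin n → ℝ) (ρ : ℝ → Fin m → ℝ) (t : ℝ)
    (hy : HasDerivAt y ((A + B * F) *ᵥ y t + B *ᵥ ρ t) t) :
    HasDerivAt (fun s => y s ⬝ᵥ (P *ᵥ y s))
      (-γ * (y t ⬝ᵥ (P *ᵥ y t)) - (y t ⬝ᵥ ((P * B * Bᵀ * P) *ᵥ y t))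
        + 2 * (y t ⬝ᵥ ((P * B) *ᵥ ρ t))) t ∧
    -γ * (y t ⬝ᵥ (P *ᵥ y t)) - (y t ⬝ᵥ ((P * B * Bᵀ * P) *ᵥ y t))
        + 2 * (y t ⬝ᵥ ((P * B) *ᵥ ρ t))
      ≤ -γ * (y t ⬝ᵥ (P *ᵥ y t)) + ρ t ⬝ᵥ ρ t := by
  have hsymm : Pᵀ = P := by simpa [conjTranspose_eq_transpose_of_trivial] using hP.isHermitian.eq
  constructor
  · convert hy.dotProduct (hy.const_mulVec P) using 1
    rw [dotProduct_comm _ (P *ᵥ y t), dotProduct_comm (P *ᵥ y t),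
      dotProduct_mulVec_eq_transpose P ((A + B * F) *ᵥ y t + B *ᵥ ρ t), hsymm]
    have hquad := congrArg (fun M => y t ⬝ᵥ (M *ᵥ y t)) hare
    have hcross : y t ⬝ᵥ ((Aᵀ * P) *ᵥ y t) = y t ⬝ᵥ ((P * A) *ᵥ y t) := by
      rw [dotProduct_mulVec_eq_transpose, transpose_mul, transpose_transpose, hsymm]
    simp only [sub_mulVec, add_mulVec, neg_mulVec, smul_mulVec, dotProduct_sub, dotProduct_add,
      dotProduct_neg, dotProduct_smul, smul_eq_mul, hcross] at hquad
    simp only [hF, mulVec_add, mulVec_mulVec, Matrix.mul_neg, add_mulVec, neg_mulVec, mulVec_neg,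
      dotProduct_add, dotProduct_neg, ← Matrix.mul_assoc]
    linarith
  · have hq : y t ⬝ᵥ ((P * B * Bᵀ * P) *ᵥ y t) =
        ((Bᵀ * P) *ᵥ y t) ⬝ᵥ ((Bᵀ * P) *ᵥ y t) := by
      rw [dotProduct_mulVec_eq_transpose (Bᵀ * P), transpose_mul, transpose_transpose, hsymm,
        mulVec_mulVec, ← Matrix.mul_assoc]
    have hc : y t ⬝ᵥ ((P * B) *ᵥ ρ t) = ρ t ⬝ᵥ ((Bᵀ * P) *ᵥ y t) := by
      rw [dotProduct_mulVec_eq_transpose, transpose_mul, hsymm]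
    rw [hq, hc]
    have hsq : 0 ≤ ((Bᵀ * P) *ᵥ y t - ρ t) ⬝ᵥ ((Bᵀ * P) *ᵥ y t - ρ t) :=
      Finset.sum_nonneg fun i _ => mul_self_nonneg _
    rw [sub_dotProduct, dotProduct_sub, dotProduct_sub,
      dotProduct_comm ((Bᵀ * P) *ᵥ y t) (ρ t)] at hsq
    linarith
end
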